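/- arXiv:1404.5741 — 4 statements merged into one kernel-verified Lean document; each statement's English description precedes it below -/
import Mathlib

section
/- For every continuous function z : [0,T] → ℝⁿ and every initial datum x₀ ∈ ℝⁿ, there exists a unique pair of continuously differentiable functions ξ, η : [0,T] → ℝⁿ satisfying the forward–backward system ξ'(t) = A_tξ(t) − B_tR_t⁻¹B_t^*η(t) + Ā_t z(t), ξ(0) = x₀, −η'(t) = A_t^*η(t) + Q_tξ(t) + 𝒮_t z(t), η(T) = Q_Tξ(T) + 𝒮_T z(T). (This system corresponds to a strictly convex coercive deterministic linear–quadratic control problem and is hence uniquely solvable.) -/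
open Matrix Set

noncomputable section

/-- Solution predicate for the forward–backward system of Theorem 3.1:
`ξ' = A ξ − B R⁻¹ Bᵀ η + Ā z`, `ξ 0 = x₀`,
`−η' = Aᵀ η + Q ξ + 𝒮 z`, `η T = Q_T ξ(T) + 𝒮_T z(T)`,
where `𝒮_t = Q̄_t (I − S_t)` and `𝒮_T = Q̄_T (I − S_T)`. -/
def IsFBSol (n m : ℕ) (T : ℝ)
    (A Abar S Q Qbar : ℝ → Matrix (Fin n) (Fin n) ℝ)
    (B : ℝ → Matrix (Fin n) (Fin m) ℝ)
    (R : ℝ → Matrix (Fin m) (Fin m) ℝ)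
    (QT QbarT ST : Matrix (Fin n) (Fin n) ℝ)
    (z : ℝ → Fin n → ℝ) (x₀ : Fin n → ℝ)
    (ξ η : ℝ → Fin n → ℝ) : Prop :=
  (∀ t ∈ Set.Icc (0:ℝ) T, HasDerivWithinAt ξ
      ((A t) *ᵥ ξ t - (B t * (R t)⁻¹ * (B t)ᵀ) *ᵥ η t + (Abar t) *ᵥ z t)
      (Set.Icc (0:ℝ) T) t) ∧
  ξ 0 = x₀ ∧
  (∀ t ∈ Set.Icc (0:ℝ) T, HasDerivWithinAt η
      (-((A t)ᵀ *ᵥ η t + (Q t) *ᵥ ξ t + (Qbar t * (1 - S t)) *ᵥ z t))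
      (Set.Icc (0:ℝ) T) t) ∧
  η T = QT *ᵥ ξ T + (QbarT * (1 - ST)) *ᵥ z T

open scoped NNReal

/-- Continuous matrix-valued functions on a compact set are uniformly bounded as operators. -/
lemma exists_norm_mulVec_le {ι κ : Type*} [Fintype ι] [Fintype κ] {s : Set ℝ} (hs : IsCompact s)
    {M : ℝ → Matrix ι κ ℝ} (hM : ContinuousOn M s) :
    ∃ K : ℝ≥0, ∀ t ∈ s, ∀ x : κ → ℝ, ‖M t *ᵥ x‖ ≤ K * ‖x‖ := by
  classical
  let Λ : Matrix ι κ ℝ →ₗ[ℝ] ((κ → ℝ) →L[ℝ] (ι → ℝ)) :=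
    (LinearMap.toContinuousLinearMap (𝕜 := ℝ) (E := κ → ℝ) (F' := ι → ℝ)).toLinearMap ∘ₗ
      (Matrix.toLin' (R := ℝ) (m := ι) (n := κ)).toLinearMap
  have hΛ : Continuous Λ := Λ.continuous_of_finiteDimensional
  obtain ⟨C, hC⟩ := hs.exists_bound_of_continuousOn (hΛ.comp_continuousOn hM)
  refine ⟨C.toNNReal, fun t ht x ↦ ?_⟩
  calc ‖M t *ᵥ x‖ = ‖Λ (M t) x‖ := rfl
    _ ≤ ‖Λ (M t)‖ * ‖x‖ := (Λ (M t)).le_opNorm x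
    _ ≤ C.toNNReal * ‖x‖ := by
      gcongr
      exact (hC t ht).trans (Real.le_coe_toNNReal C)

/-- Two solutions of a linear equation on `[a, b]` that agree at `a` are equal. -/
lemma eqOn_of_linearODE_of_eq_left {ι : Type*} [Fintype ι] {a b : ℝ} {M : ℝ → Matrix ι ι ℝ}
    (hM : ContinuousOn M (Icc a b)) {f x y : ℝ → ι → ℝ}
    (hx : ∀ t ∈ Icc a b, HasDerivWithinAt x (M t *ᵥ x t + f t) (Icc a b) t)
    (hy : ∀ t ∈ Icc a b, HasDerivWithinAt y (M t *ᵥ y t + f t) (Icc a b) t)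
    (h : x a = y a) : EqOn x y (Icc a b) := by
  obtain ⟨K, hK⟩ := exists_norm_mulVec_le isCompact_Icc hM
  refine ODE_solution_unique_of_mem_Icc_right (v := fun t u ↦ M t *ᵥ u + f t) (K := K)
    (s := fun _ ↦ univ) (fun t ht ↦ LipschitzOnWith.of_dist_le_mul fun u _ w _ ↦ ?_)
    (fun t ht ↦ (hx t ht).continuousWithinAt) (fun t ht ↦ ?_) (fun _ _ ↦ mem_univ _)
    (fun t ht ↦ (hy t ht).continuousWithinAt) (fun t ht ↦ ?_) (fun _ _ ↦ mem_univ _) h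
  · rw [dist_add_right, dist_eq_norm, dist_eq_norm, ← mulVec_sub]
    exact hK t (Ico_subset_Icc_self ht) _
  · exact (hx t (Ico_subset_Icc_self ht)).mono_of_mem_nhdsWithin (Icc_mem_nhdsGE_of_mem ht)
  · exact (hy t (Ico_subset_Icc_self ht)).mono_of_mem_nhdsWithin (Icc_mem_nhdsGE_of_mem ht)

/-- Two solutions of a linear equation on `[a, b]` that agree at `b` are equal. -/
lemma eqOn_of_linearODE_of_eq_right {ι : Type*} [Fintype ι] {a b : ℝ} {M : ℝ → Matrix ι ι ℝ}
    (hM : ContinuousOn M (Icc a b)) {f x y : ℝ → ι → ℝ}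
    (hx : ∀ t ∈ Icc a b, HasDerivWithinAt x (M t *ᵥ x t + f t) (Icc a b) t)
    (hy : ∀ t ∈ Icc a b, HasDerivWithinAt y (M t *ᵥ y t + f t) (Icc a b) t)
    (h : x b = y b) : EqOn x y (Icc a b) := by
  obtain ⟨K, hK⟩ := exists_norm_mulVec_le isCompact_Icc hM
  refine ODE_solution_unique_of_mem_Icc_left (v := fun t u ↦ M t *ᵥ u + f t) (K := K)
    (s := fun _ ↦ univ) (fun t ht ↦ LipschitzOnWith.of_dist_le_mul fun u _ w _ ↦ ?_)
    (fun t ht ↦ (hx t ht).continuousWithinAt) (fun t ht ↦ ?_) (fun _ _ ↦ mem_univ _)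
    (fun t ht ↦ (hy t ht).continuousWithinAt) (fun t ht ↦ ?_) (fun _ _ ↦ mem_univ _) h
  · rw [dist_add_right, dist_eq_norm, dist_eq_norm, ← mulVec_sub]
    exact hK t (Ioc_subset_Icc_self ht) _
  · exact (hx t (Ioc_subset_Icc_self ht)).mono_of_mem_nhdsWithin (Icc_mem_nhdsLE_of_mem ht)
  · exact (hy t (Ioc_subset_Icc_self ht)).mono_of_mem_nhdsWithin (Icc_mem_nhdsLE_of_mem ht)

/-- Coordinatewise truncation of a vector to the cube `[-r, r]^ι`. -/
def clampVec {ι : Type*} (r : ℝ) (x : ι → ℝ) : ι → ℝ := fun i ↦ max (-r) (min r (x i))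

lemma norm_clampVec_sub_le {ι : Type*} [Fintype ι] (r : ℝ) (x y : ι → ℝ) :
    ‖clampVec r x - clampVec r y‖ ≤ ‖x - y‖ := by
  refine (pi_norm_le_iff_of_nonneg (norm_nonneg _)).2 fun i ↦ le_trans ?_ (norm_le_pi_norm _ i)
  simp only [clampVec, Pi.sub_apply, Real.norm_eq_abs]
  calc |max (-r) (min r (x i)) - max (-r) (min r (y i))|
      ≤ |min r (x i) - min r (y i)| := by
        simpa using abs_max_sub_max_le_max (-r) (min r (x i)) (-r) (min r (y i))
    _ ≤ |x i - y i| := by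
        simpa using abs_min_sub_min_le_max r (x i) r (y i)

lemma clampVec_of_norm_le {ι : Type*} [Fintype ι] {r : ℝ} {x : ι → ℝ} (h : ‖x‖ ≤ r) :
    clampVec r x = x := by
  ext i
  have := abs_le.1 ((norm_le_pi_norm x i).trans h)
  simp [clampVec, this.1, this.2]

lemma norm_clampVec_le_norm {ι : Type*} [Fintype ι] {r : ℝ} (hr : 0 ≤ r) (x : ι → ℝ) :
    ‖clampVec r x‖ ≤ ‖x‖ := by
  have h0 : clampVec r (0 : ι → ℝ) = 0 := clampVec_of_norm_le (by simpa using hr)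
  simpa [h0] using norm_clampVec_sub_le r x 0

lemma norm_clampVec_le {ι : Type*} [Fintype ι] {r : ℝ} (hr : 0 ≤ r) (x : ι → ℝ) :
    ‖clampVec r x‖ ≤ r :=
  (pi_norm_le_iff_of_nonneg hr).2 fun i ↦ abs_le.2
    ⟨le_max_left _ _, max_le (by linarith) (min_le_left _ _)⟩

/-- Global existence for linear initial value problems on a compact interval. -/
lemma exists_solution_linearODE {ι : Type*} [Fintype ι] {T : ℝ} (hT : 0 ≤ T)
    {M : ℝ → Matrix ι ι ℝ} (hM : ContinuousOn M (Icc 0 T))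
    {f : ℝ → ι → ℝ} (hf : ContinuousOn f (Icc 0 T)) (x₀ : ι → ℝ) :
    ∃ x : ℝ → ι → ℝ, x 0 = x₀ ∧
      ∀ t ∈ Icc 0 T, HasDerivWithinAt x (M t *ᵥ x t + f t) (Icc 0 T) t := by
  obtain ⟨K, hK⟩ := exists_norm_mulVec_le isCompact_Icc hM
  obtain ⟨C, hC⟩ := isCompact_Icc.exists_bound_of_continuousOn hf
  have hC0 : 0 ≤ C := (norm_nonneg _).trans (hC 0 ⟨le_rfl, hT⟩)
  set r : ℝ := gronwallBound ‖x₀‖ K C T with hr_def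
  have hmono := gronwallBound_mono (norm_nonneg x₀) hC0 K.coe_nonneg
  have hr : 0 ≤ r := by
    refine (norm_nonneg x₀).trans ?_
    simpa [gronwallBound_x0] using hmono hT
  -- the truncated field is bounded, so Picard–Lindelöf applies on the whole interval
  let v : ℝ → (ι → ℝ) → ι → ℝ := fun t u ↦ M t *ᵥ clampVec r u + f t
  let L : ℝ≥0 := K * r.toNNReal + C.toNNReal
  have hv : IsPicardLindelof v (⟨0, le_rfl, hT⟩ : Icc (0 : ℝ) T) x₀ (L * T.toNNReal) 0 L K :=
    { lipschitzOnWith := fun t ht ↦ LipschitzOnWith.of_dist_le_mul fun u _ w _ ↦ by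
        simp only [v]
        rw [dist_add_right, dist_eq_norm, dist_eq_norm, ← mulVec_sub]
        refine (hK t ht _).trans ?_
        gcongr
        exact norm_clampVec_sub_le _ _ _
      continuousOn := fun u _ ↦ by
        refine ContinuousOn.add ?_ hf
        exact (Continuous.matrix_mulVec continuous_id continuous_const).comp_continuousOn hM
      norm_le := fun t ht u _ ↦ by
        simp only [v, L, NNReal.coe_add, NNReal.coe_mul, Real.coe_toNNReal r hr,
          Real.coe_toNNReal C hC0]
        refine (norm_add_le _ _).trans (add_le_add ((hK t ht _).trans ?_) (hC t ht))
        gcongr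
        exact norm_clampVec_le hr u
      mul_max_le := by simp [hT] }
  obtain ⟨x, hx0, hx⟩ := hv.exists_eq_forall_mem_Icc_hasDerivWithinAt₀
  refine ⟨x, hx0, fun t ht ↦ ?_⟩
  have hbound : ‖x t‖ ≤ r := by
    refine (norm_le_gronwallBound_of_norm_deriv_right_le (δ := ‖x₀‖) (K := K) (ε := C)
      (fun s hs ↦ (hx s hs).continuousWithinAt)
      (fun s hs ↦ (hx s (Ico_subset_Icc_self hs)).mono_of_mem_nhdsWithin
        (Icc_mem_nhdsGE_of_mem hs)) (by simp [← hx0]) (fun s hs ↦ ?_) t ht).trans ?_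
    · have hs' := Ico_subset_Icc_self hs
      refine (norm_add_le _ _).trans (add_le_add ((hK s hs' _).trans ?_) (hC s hs'))
      gcongr
      exact norm_clampVec_le_norm hr _
    · exact hmono (by simpa using ht.2)
  simpa only [v, clampVec_of_norm_le hbound] using hx t ht

/-- A homogeneous linear equation has a linear solution flow. -/
lemma exists_linear_flow {ι : Type*} [Fintype ι] {T : ℝ} (hT : 0 ≤ T)
    {M : ℝ → Matrix ι ι ℝ} (hM : ContinuousOn M (Icc 0 T)) :
    ∃ Φ : ℝ → (ι → ℝ) →ₗ[ℝ] (ι → ℝ), (∀ u, Φ 0 u = u) ∧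
      ∀ u, ∀ t ∈ Icc 0 T, HasDerivWithinAt (fun s ↦ Φ s u) (M t *ᵥ Φ t u) (Icc 0 T) t := by
  classical
  choose X hX0 hX using fun i : ι ↦
    exists_solution_linearODE hT hM (f := 0) continuousOn_const (Pi.single i 1)
  refine ⟨fun t ↦ Fintype.linearCombination ℝ (fun i ↦ X i t), fun u ↦ ?_, fun u t ht ↦ ?_⟩
  · simp only [Fintype.linearCombination_apply, hX0]
    exact (pi_eq_sum_univ' u).symm
  · simp only [Fintype.linearCombination_apply, mulVec_sum, mulVec_smul]
    refine HasDerivWithinAt.fun_sum fun i _ ↦ ?_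
    simpa using! (hX i t ht).const_smul (u i)

lemma HasDerivWithinAt.dotProduct {ι : Type*} [Fintype ι] {x y : ℝ → ι → ℝ} {x' y' : ι → ℝ}
    {s : Set ℝ} {t : ℝ} (hx : HasDerivWithinAt x x' s t) (hy : HasDerivWithinAt y y' s t) :
    HasDerivWithinAt (fun r ↦ x r ⬝ᵥ y r) (x' ⬝ᵥ y t + x t ⬝ᵥ y') s t := by
  simp only [_root_.dotProduct, ← Finset.sum_add_distrib]
  exact HasDerivWithinAt.fun_sum fun i _ ↦
    (hasDerivWithinAt_pi.1 hx i).mul (hasDerivWithinAt_pi.1 hy i)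

/-- The homogeneous forward–backward system has only the trivial solution. -/
lemma forwardBackward_homogeneous_eq_zero {ι : Type*} [Fintype ι] {T : ℝ} (hT : 0 < T)
    {A G Q : ℝ → Matrix ι ι ℝ} {P : Matrix ι ι ℝ}
    (hA : ContinuousOn A (Icc 0 T))
    (hG : ∀ t ∈ Icc 0 T, (G t).PosSemidef) (hQ : ∀ t ∈ Icc 0 T, (Q t).PosSemidef)
    (hP : P.PosSemidef) {ξ η : ℝ → ι → ℝ}
    (hξ : ∀ t ∈ Icc 0 T, HasDerivWithinAt ξ (A t *ᵥ ξ t - G t *ᵥ η t) (Icc 0 T) t)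
    (hη : ∀ t ∈ Icc 0 T, HasDerivWithinAt η (-((A t)ᵀ *ᵥ η t + Q t *ᵥ ξ t)) (Icc 0 T) t)
    (hξ0 : ξ 0 = 0) (hηT : η T = P *ᵥ ξ T) :
    ∀ t ∈ Icc 0 T, ξ t = 0 ∧ η t = 0 := by
  have h0 : (0 : ℝ) ∈ Icc 0 T := ⟨le_rfl, hT.le⟩
  have h1 : T ∈ Icc 0 T := ⟨hT.le, le_rfl⟩
  have hGnn : ∀ t ∈ Icc 0 T, 0 ≤ η t ⬝ᵥ G t *ᵥ η t := fun t ht ↦ by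
    simpa using (hG t ht).dotProduct_mulVec_nonneg (η t)
  have hQnn : ∀ t ∈ Icc 0 T, 0 ≤ ξ t ⬝ᵥ Q t *ᵥ ξ t := fun t ht ↦ by
    simpa using (hQ t ht).dotProduct_mulVec_nonneg (ξ t)
  -- the pairing `ξ ⬝ᵥ η` is nonincreasing, starts at zero and ends nonnegative
  have hd : ∀ t ∈ Icc 0 T, HasDerivWithinAt (fun s ↦ ξ s ⬝ᵥ η s)
      (-(η t ⬝ᵥ G t *ᵥ η t + ξ t ⬝ᵥ Q t *ᵥ ξ t)) (Icc 0 T) t := fun t ht ↦ by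
    refine ((hξ t ht).dotProduct (hη t ht)).congr_deriv ?_
    rw [sub_dotProduct, dotProduct_neg, dotProduct_add, dotProduct_mulVec (ξ t) (A t)ᵀ,
      vecMul_transpose, dotProduct_comm (G t *ᵥ η t)]
    ring
  have hanti : AntitoneOn (fun s ↦ ξ s ⬝ᵥ η s) (Icc 0 T) := by
    refine antitoneOn_of_hasDerivWithinAt_nonpos (convex_Icc 0 T)
      (fun t ht ↦ (hd t ht).continuousWithinAt)
      (fun t ht ↦ (hd t (interior_subset ht)).mono interior_subset) fun t ht ↦ ?_
    have := hGnn t (interior_subset ht)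
    have := hQnn t (interior_subset ht)
    linarith
  have hzero : ∀ t ∈ Icc 0 T, ξ t ⬝ᵥ η t = 0 := fun t ht ↦ by
    have hl := hanti h0 ht ht.1
    have hr := hanti ht h1 ht.2
    have hPT : 0 ≤ ξ T ⬝ᵥ P *ᵥ ξ T := by simpa using hP.dotProduct_mulVec_nonneg (ξ T)
    simp only [hξ0, zero_dotProduct, hηT] at hl hr
    linarith
  have hGη : ∀ t ∈ Icc 0 T, G t *ᵥ η t = 0 := fun t ht ↦ by
    have hc : HasDerivWithinAt (fun s ↦ ξ s ⬝ᵥ η s) 0 (Icc 0 T) t :=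
      (hasDerivWithinAt_const t (Icc 0 T) (0 : ℝ)).congr hzero (hzero t ht)
    have he := (uniqueDiffOn_Icc hT t ht).eq_deriv _ (hd t ht) hc
    have := hGnn t ht
    have := hQnn t ht
    refine ((hG t ht).dotProduct_mulVec_zero_iff (η t)).1 ?_
    rw [star_trivial]
    linarith
  have hξz : EqOn ξ (fun _ ↦ 0) (Icc 0 T) := by
    refine eqOn_of_linearODE_of_eq_left hA (f := 0) (fun t ht ↦ ?_) (fun t ht ↦ ?_) hξ0
    · simpa [hGη t ht] using hξ t ht
    · simpa using hasDerivWithinAt_const t (Icc 0 T) (0 : ι → ℝ)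
  have hηz : EqOn η (fun _ ↦ 0) (Icc 0 T) := by
    refine eqOn_of_linearODE_of_eq_right (M := fun t ↦ -(A t)ᵀ)
      ((continuous_id.matrix_transpose.neg).comp_continuousOn hA) (f := 0)
      (fun t ht ↦ ?_) (fun t ht ↦ ?_) ?_
    · simpa [hξz ht, neg_mulVec] using hη t ht
    · simpa using hasDerivWithinAt_const t (Icc 0 T) (0 : ι → ℝ)
    · simp [hηT, hξz h1]
  exact fun t ht ↦ ⟨hξz ht, hηz ht⟩

/-- Solvability of the inhomogeneous forward–backward system, by shooting. -/
lemma exists_forwardBackward_solution {ι : Type*} [Fintype ι] {T : ℝ} (hT : 0 < T)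
    {A G Q : ℝ → Matrix ι ι ℝ} {P : Matrix ι ι ℝ}
    (hA : ContinuousOn A (Icc 0 T)) (hGc : ContinuousOn G (Icc 0 T))
    (hQc : ContinuousOn Q (Icc 0 T))
    (hG : ∀ t ∈ Icc 0 T, (G t).PosSemidef) (hQ : ∀ t ∈ Icc 0 T, (Q t).PosSemidef)
    (hP : P.PosSemidef) {f g : ℝ → ι → ℝ} (hf : ContinuousOn f (Icc 0 T))
    (hg : ContinuousOn g (Icc 0 T)) (x₀ c : ι → ℝ) :
    ∃ ξ η : ℝ → ι → ℝ,
      (∀ t ∈ Icc 0 T, HasDerivWithinAt ξ (A t *ᵥ ξ t - G t *ᵥ η t + f t) (Icc 0 T) t) ∧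
      ξ 0 = x₀ ∧
      (∀ t ∈ Icc 0 T,
        HasDerivWithinAt η (-((A t)ᵀ *ᵥ η t + Q t *ᵥ ξ t + g t)) (Icc 0 T) t) ∧
      η T = P *ᵥ ξ T + c := by
  have h0 : (0 : ℝ) ∈ Icc 0 T := ⟨le_rfl, hT.le⟩
  let M : ℝ → Matrix (ι ⊕ ι) (ι ⊕ ι) ℝ := fun t ↦ fromBlocks (A t) (-G t) (-Q t) (-(A t)ᵀ)
  have hM : ContinuousOn M (Icc 0 T) := by
    rw [continuousOn_iff_continuous_domRestrict] at *
    exact Continuous.matrix_fromBlocks hA hGc.neg hQc.neg hA.matrix_transpose.neg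
  let F : ℝ → ι ⊕ ι → ℝ := fun t ↦ Sum.elim (f t) (-g t)
  have hF : ContinuousOn F (Icc 0 T) := by
    refine continuousOn_pi.2 ?_
    rintro (i | i)
    · exact continuousOn_pi.1 hf i
    · exact (continuousOn_pi.1 hg i).neg
  have hMul : ∀ t (u : ι ⊕ ι → ℝ), M t *ᵥ u =
      Sum.elim (A t *ᵥ (u ∘ Sum.inl) - G t *ᵥ (u ∘ Sum.inr))
        (-((A t)ᵀ *ᵥ (u ∘ Sum.inr) + Q t *ᵥ (u ∘ Sum.inl))) := fun t u ↦ by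
    simp only [M, fromBlocks_mulVec, neg_mulVec]
    congr 1
    abel
  obtain ⟨Φ, hΦ0, hΦ⟩ := exists_linear_flow hT.le hM
  obtain ⟨Y, hY0, hY⟩ := exists_solution_linearODE hT.le hM hF (Sum.elim x₀ 0)
  let E : (ι → ℝ) →ₗ[ℝ] (ι → ℝ) :=
    { toFun := fun p ↦ (Φ T (Sum.elim 0 p)) ∘ Sum.inr - P *ᵥ ((Φ T (Sum.elim 0 p)) ∘ Sum.inl)
      map_add' := fun p q ↦ by
        have : (Sum.elim 0 (p + q) : ι ⊕ ι → ℝ) =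
            Sum.elim (0 : ι → ℝ) p + Sum.elim (0 : ι → ℝ) q := by
          ext (i | i) <;> simp
        rw [this, map_add, Pi.add_comp, Pi.add_comp, mulVec_add]
        abel
      map_smul' := fun a p ↦ by
        have : (Sum.elim 0 (a • p) : ι ⊕ ι → ℝ) = a • Sum.elim (0 : ι → ℝ) p := by
          ext (i | i) <;> simp
        rw [this, map_smul, Pi.smul_comp, Pi.smul_comp, mulVec_smul, ← smul_sub]
        rfl }
  have hE : Function.Injective E := by
    refine (injective_iff_map_eq_zero E).2 fun p hp ↦ ?_
    have := (forwardBackward_homogeneous_eq_zero hT hA hG hQ hP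
      (ξ := fun t ↦ Φ t (Sum.elim 0 p) ∘ Sum.inl) (η := fun t ↦ Φ t (Sum.elim 0 p) ∘ Sum.inr)
      (fun t ht ↦ hasDerivWithinAt_pi.2 fun i ↦ by
        simpa [hMul] using hasDerivWithinAt_pi.1 (hΦ (Sum.elim 0 p) t ht) (Sum.inl i))
      (fun t ht ↦ hasDerivWithinAt_pi.2 fun i ↦ by
        simpa [hMul] using hasDerivWithinAt_pi.1 (hΦ (Sum.elim 0 p) t ht) (Sum.inr i))
      (by simp [hΦ0]) (sub_eq_zero.1 hp) 0 h0).2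
    simpa [hΦ0] using this
  obtain ⟨p, hp⟩ := LinearMap.injective_iff_surjective.1 hE
    (c + P *ᵥ (Y T ∘ Sum.inl) - Y T ∘ Sum.inr)
  have hX : ∀ t ∈ Icc 0 T, HasDerivWithinAt (fun s ↦ Y s + Φ s (Sum.elim 0 p))
      (M t *ᵥ (Y t + Φ t (Sum.elim 0 p)) + F t) (Icc 0 T) t := fun t ht ↦ by
    refine ((hY t ht).add (hΦ (Sum.elim 0 p) t ht)).congr_deriv ?_
    rw [mulVec_add]
    abel
  refine ⟨fun t ↦ (Y t + Φ t (Sum.elim 0 p)) ∘ Sum.inl,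
    fun t ↦ (Y t + Φ t (Sum.elim 0 p)) ∘ Sum.inr,
    fun t ht ↦ hasDerivWithinAt_pi.2 fun i ↦ ?_, ?_,
    fun t ht ↦ hasDerivWithinAt_pi.2 fun i ↦ ?_, ?_⟩
  · simpa only [hMul, F] using! hasDerivWithinAt_pi.1 (hX t ht) (Sum.inl i)
  · simp [hΦ0, hY0, Pi.add_comp]
  · refine (hasDerivWithinAt_pi.1 (hX t ht) (Sum.inr i)).congr_deriv ?_
    simp only [hMul, F, Pi.add_apply, Pi.neg_apply, Sum.elim_inr]
    ring
  · have hp' : Φ T (Sum.elim 0 p) ∘ Sum.inr - P *ᵥ (Φ T (Sum.elim 0 p) ∘ Sum.inl) =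
      c + P *ᵥ (Y T ∘ Sum.inl) - Y T ∘ Sum.inr := hp
    simp only [Pi.add_comp, mulVec_add]
    rw [sub_eq_iff_eq_add.1 hp']
    abel

/-- Theorem 3.1, unique solvability of the stochastic-maximum-principle
system for a fixed mean-field term `z`: for every continuous `z` and every initial datum
`x₀` there is a unique pair `(ξ, η)` solving the forward–backward system on `[0, T]`. -/
theorem exists_unique_FBSol
    (n m : ℕ) (T : ℝ) (hT : 0 < T)
    (A Abar S Q Qbar : ℝ → Matrix (Fin n) (Fin n) ℝ)
    (B : ℝ → Matrix (Fin n) (Fin m) ℝ)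
    (R : ℝ → Matrix (Fin m) (Fin m) ℝ)
    (QT QbarT ST : Matrix (Fin n) (Fin n) ℝ)
    (hAc : ContinuousOn A (Set.Icc 0 T)) (hAbarc : ContinuousOn Abar (Set.Icc 0 T))
    (hBc : ContinuousOn B (Set.Icc 0 T)) (hSc : ContinuousOn S (Set.Icc 0 T))
    (hQc : ContinuousOn Q (Set.Icc 0 T)) (hQbarc : ContinuousOn Qbar (Set.Icc 0 T))
    (hRc : ContinuousOn R (Set.Icc 0 T))
    (hQ : ∀ t ∈ Set.Icc (0:ℝ) T, (Q t).PosSemidef)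
    (hQbar : ∀ t ∈ Set.Icc (0:ℝ) T, (Qbar t).PosSemidef)
    (hR : ∀ t ∈ Set.Icc (0:ℝ) T, (R t).PosDef)
    (δ : ℝ) (hδ : 0 < δ)
    (hRδ : ∀ t ∈ Set.Icc (0:ℝ) T,
      (R t - δ • (1 : Matrix (Fin m) (Fin m) ℝ)).PosSemidef)
    (hQT : QT.PosSemidef) (hQbarT : QbarT.PosSemidef)
    (z : ℝ → Fin n → ℝ) (hz : ContinuousOn z (Set.Icc 0 T))
    (x₀ : Fin n → ℝ) :
    (∃ ξ η : ℝ → Fin n → ℝ,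
        IsFBSol n m T A Abar S Q Qbar B R QT QbarT ST z x₀ ξ η) ∧
    (∀ ξ₁ η₁ ξ₂ η₂ : ℝ → Fin n → ℝ,
        IsFBSol n m T A Abar S Q Qbar B R QT QbarT ST z x₀ ξ₁ η₁ →
        IsFBSol n m T A Abar S Q Qbar B R QT QbarT ST z x₀ ξ₂ η₂ →
        ∀ t ∈ Set.Icc (0:ℝ) T, ξ₁ t = ξ₂ t ∧ η₁ t = η₂ t) := by
  set G : ℝ → Matrix (Fin n) (Fin n) ℝ := fun t ↦ B t * (R t)⁻¹ * (B t)ᵀ with hG_def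
  have hRinv : ContinuousOn (fun t ↦ (R t)⁻¹) (Icc 0 T) := fun t ht ↦ by
    have hdet : (R t).det ≠ 0 := (hR t ht).det_pos.ne'
    refine ContinuousAt.comp_continuousWithinAt
      (continuousAt_matrix_inv (R t) ?_) (hRc t ht)
    simpa using continuousAt_inv₀ hdet
  have hGc : ContinuousOn G (Icc 0 T) := by
    rw [continuousOn_iff_continuous_domRestrict] at hBc hRinv ⊢
    exact (hBc.matrix_mul hRinv).matrix_mul hBc.matrix_transpose
  have hG : ∀ t ∈ Icc 0 T, (G t).PosSemidef := fun t ht ↦ by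
    simpa [G, conjTranspose_eq_transpose_of_trivial] using
      (hR t ht).inv.posSemidef.mul_mul_conjTranspose_same (B t)
  refine ⟨?_, fun ξ₁ η₁ ξ₂ η₂ ⟨hξ₁, hi₁, hη₁, he₁⟩ ⟨hξ₂, hi₂, hη₂, he₂⟩ t ht ↦ ?_⟩
  · refine exists_forwardBackward_solution hT hAc hGc hQc hG hQ hQT
      (f := fun t ↦ Abar t *ᵥ z t) (g := fun t ↦ (Qbar t * (1 - S t)) *ᵥ z t) ?_ ?_ x₀ _
    · rw [continuousOn_iff_continuous_domRestrict] at hAbarc hz ⊢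
      exact hAbarc.matrix_mulVec hz
    · rw [continuousOn_iff_continuous_domRestrict] at hQbarc hSc hz ⊢
      exact (hQbarc.matrix_mul (continuous_const.sub hSc)).matrix_mulVec hz
  · have := forwardBackward_homogeneous_eq_zero hT hAc hG hQ hQT
      (ξ := fun t ↦ ξ₁ t - ξ₂ t) (η := fun t ↦ η₁ t - η₂ t)
      (fun t ht ↦ by
        refine ((hξ₁ t ht).sub (hξ₂ t ht)).congr_deriv ?_
        simp only [G, mulVec_sub]
        abel)
      (fun t ht ↦ by
        refine ((hη₁ t ht).sub (hη₂ t ht)).congr_deriv ?_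
        simp only [mulVec_sub]
        abel)
      (by simp [hi₁, hi₂]) (by simp [he₁, he₂, mulVec_sub]) t ht
    exact ⟨sub_eq_zero.1 this.1, sub_eq_zero.1 this.2⟩

end
end

section
/- Suppose all coefficient matrices A, Ā, B, Q, Q̄, R, S are constant in time, with Ā = 0, and suppose the matrix Q + Q̄(I − S) is symmetric and positive definite, and likewise the terminal weight Q_T + Q̄_T(I − S_T) is symmetric positive semidefinite. Then for every initial datum x̄₀ ∈ ℝⁿ the forward–backward system (NewRic) admits a unique solution (ξ, η) on [0,T]. -/
open Matrix Set

noncomputable section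

/-- Solution predicate for the constant-coefficient forward–backward system (NewRic):
`ξ' = (A + Ā) ξ − B R⁻¹ Bᵀ η`, `ξ 0 = x̄₀`,
`−η' = (Q + 𝒮) ξ + Aᵀ η`, `η T = (Q_T + 𝒮_T) ξ(T)`. -/
def IsNewRicSolConst (n m : ℕ) (T : ℝ)
    (A Abar S Q Qbar : Matrix (Fin n) (Fin n) ℝ)
    (B : Matrix (Fin n) (Fin m) ℝ)
    (R : Matrix (Fin m) (Fin m) ℝ)
    (QT QbarT ST : Matrix (Fin n) (Fin n) ℝ)
    (x₀ : Fin n → ℝ) (ξ η : ℝ → Fin n → ℝ) : Prop :=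
  (∀ t ∈ Set.Icc (0:ℝ) T, HasDerivWithinAt ξ
      ((A + Abar) *ᵥ ξ t - (B * R⁻¹ * Bᵀ) *ᵥ η t)
      (Set.Icc (0:ℝ) T) t) ∧
  ξ 0 = x₀ ∧
  (∀ t ∈ Set.Icc (0:ℝ) T, HasDerivWithinAt η
      (-((Q + Qbar * (1 - S)) *ᵥ ξ t + Aᵀ *ᵥ η t))
      (Set.Icc (0:ℝ) T) t) ∧
  η T = (QT + QbarT * (1 - ST)) *ᵥ ξ T

/-- A linear forward–backward system with zero initial datum, monotone coupling and monotone
terminal condition has only the trivial solution. -/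
theorem eq_zero_of_forwardBackward {n : ℕ} {T : ℝ} {A G K P : Matrix (Fin n) (Fin n) ℝ}
    (hT : 0 ≤ T) (hG : G.PosSemidef) (hK : K.PosDef) (hP : P.PosSemidef)
    {ξ η : ℝ → Fin n → ℝ}
    (hξ : ∀ t ∈ Icc (0 : ℝ) T, HasDerivWithinAt ξ (A *ᵥ ξ t - G *ᵥ η t) (Icc (0 : ℝ) T) t)
    (hξ₀ : ξ 0 = 0)
    (hη : ∀ t ∈ Icc (0 : ℝ) T, HasDerivWithinAt η (-(K *ᵥ ξ t + Aᵀ *ᵥ η t)) (Icc (0 : ℝ) T) t)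
    (hηT : η T = P *ᵥ ξ T) :
    ∀ t ∈ Icc (0 : ℝ) T, ξ t = 0 ∧ η t = 0 := by
  rcases hT.eq_or_lt with rfl | hT'
  · intro t ht
    obtain rfl : t = 0 := le_antisymm ht.2 ht.1
    simp [hηT, hξ₀]
  have hderiv : ∀ t ∈ Icc (0 : ℝ) T, HasDerivWithinAt (fun s => ξ s ⬝ᵥ η s)
      (-(η t ⬝ᵥ G *ᵥ η t + ξ t ⬝ᵥ K *ᵥ ξ t)) (Icc (0 : ℝ) T) t := by
    intro t ht
    have h : HasDerivWithinAt (fun s => ξ s ⬝ᵥ η s)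
        ((A *ᵥ ξ t - G *ᵥ η t) ⬝ᵥ η t + ξ t ⬝ᵥ (-(K *ᵥ ξ t + Aᵀ *ᵥ η t)))
        (Icc (0 : ℝ) T) t := by
      simp only [dotProduct, ← Finset.sum_add_distrib]
      exact HasDerivWithinAt.fun_sum fun i _ =>
        (hasDerivWithinAt_pi.1 (hξ t ht) i).mul (hasDerivWithinAt_pi.1 (hη t ht) i)
    convert h using 1
    rw [sub_dotProduct, dotProduct_neg, dotProduct_add, dotProduct_mulVec (ξ t) Aᵀ,
      vecMul_transpose, dotProduct_comm (G *ᵥ η t)]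
    ring
  have hG' : ∀ v, 0 ≤ v ⬝ᵥ G *ᵥ v := fun v => by simpa using hG.dotProduct_mulVec_nonneg v
  have hK' : ∀ v, 0 ≤ v ⬝ᵥ K *ᵥ v := fun v => by
    simpa using hK.posSemidef.dotProduct_mulVec_nonneg v
  have hanti : AntitoneOn (fun s => ξ s ⬝ᵥ η s) (Icc 0 T) := by
    refine antitoneOn_of_hasDerivWithinAt_nonpos (convex_Icc 0 T)
      (fun t ht => (hderiv t ht).continuousWithinAt)
      (fun t ht => (hderiv t (interior_subset ht)).mono interior_subset) fun t _ => ?_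
    linarith [hG' (η t), hK' (ξ t)]
  have hzero : ∀ t ∈ Icc (0 : ℝ) T, ξ t ⬝ᵥ η t = 0 := by
    intro t ht
    have h₀ : ξ t ⬝ᵥ η t ≤ ξ 0 ⬝ᵥ η 0 := hanti (left_mem_Icc.2 hT) ht ht.1
    have h₁ : ξ T ⬝ᵥ η T ≤ ξ t ⬝ᵥ η t := hanti ht (right_mem_Icc.2 hT) ht.2
    have h₂ : 0 ≤ ξ T ⬝ᵥ P *ᵥ ξ T := by simpa using hP.dotProduct_mulVec_nonneg (ξ T)
    rw [hξ₀, zero_dotProduct] at h₀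
    rw [hηT] at h₁
    linarith
  have hξ0 : ∀ t ∈ Icc (0 : ℝ) T, ξ t = 0 := by
    intro t ht
    have h := (uniqueDiffOn_Icc hT' t ht).eq_deriv _ (hderiv t ht)
      ((hasDerivWithinAt_const t (Icc 0 T) (0 : ℝ)).congr hzero (hzero t ht))
    by_contra hne
    have hpos : 0 < ξ t ⬝ᵥ K *ᵥ ξ t := by simpa using hK.dotProduct_mulVec_pos hne
    linarith [hG' (η t)]
  have hη0 : EqOn η (fun _ => 0) (Icc 0 T) := by
    refine ODE_solution_unique_of_mem_Icc_left (v := fun _ x => -(Aᵀ *ᵥ x))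
      (s := fun _ => univ) (K := ‖-(Aᵀ).mulVecLin.toContinuousLinearMap‖₊)
      (fun t _ => (-(Aᵀ).mulVecLin.toContinuousLinearMap).lipschitz.lipschitzOnWith)
      (fun t ht => (hη t ht).continuousWithinAt) (fun t ht => ?_) (fun _ _ => mem_univ _)
      continuousOn_const (fun t _ => ?_) (fun _ _ => mem_univ _) ?_
    · have h := hη t (Ioc_subset_Icc_self ht)
      rw [hξ0 t (Ioc_subset_Icc_self ht), mulVec_zero, zero_add] at h
      exact h.mono_of_mem_nhdsWithin (Icc_mem_nhdsLE_of_mem ht)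
    · simpa using hasDerivWithinAt_const t (Iic t) (0 : Fin n → ℝ)
    · simp [hηT, hξ0 T (right_mem_Icc.2 hT)]
  exact fun t ht => ⟨hξ0 t ht, hη0 ht⟩

/-- A linear forward–backward system with monotone coupling and monotone terminal condition is
solvable for every initial datum. -/
theorem exists_forwardBackward {n : ℕ} {T : ℝ} {A G K P : Matrix (Fin n) (Fin n) ℝ}
    (hT : 0 ≤ T) (hG : G.PosSemidef) (hK : K.PosDef) (hP : P.PosSemidef) (x₀ : Fin n → ℝ) :
    ∃ ξ η : ℝ → Fin n → ℝ,
      (∀ t, HasDerivAt ξ (A *ᵥ ξ t - G *ᵥ η t) t) ∧ ξ 0 = x₀ ∧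
      (∀ t, HasDerivAt η (-(K *ᵥ ξ t + Aᵀ *ᵥ η t)) t) ∧ η T = P *ᵥ ξ T := by
  let E := (Fin n → ℝ) × (Fin n → ℝ)
  let M : E →L[ℝ] E := LinearMap.toContinuousLinearMap
    ((A.mulVecLin ∘ₗ LinearMap.fst ℝ _ _ - G.mulVecLin ∘ₗ LinearMap.snd ℝ _ _).prod
      (-(K.mulVecLin ∘ₗ LinearMap.fst ℝ _ _ + (Aᵀ).mulVecLin ∘ₗ LinearMap.snd ℝ _ _)))
  let z : E → ℝ → E := fun e t => NormedSpace.exp (t • M) e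
  have hz : ∀ e t, HasDerivAt (z e) (M (z e t)) t := fun e t =>
    (hasDerivAt_exp_smul_const' M t).clm_apply (hasDerivAt_const t e) |>.congr_deriv (by simp [z])
  have hz₀ : ∀ e, z e 0 = e := fun e => by simp [z]
  have hfst : ∀ e t, HasDerivAt (fun s => (z e s).1) (A *ᵥ (z e t).1 - G *ᵥ (z e t).2) t :=
    fun e t =>
      (ContinuousLinearMap.fst ℝ (Fin n → ℝ) (Fin n → ℝ)).hasFDerivAt.comp_hasDerivAt t (hz e t)
  have hsnd : ∀ e t, HasDerivAt (fun s => (z e s).2)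
      (-(K *ᵥ (z e t).1 + Aᵀ *ᵥ (z e t).2)) t :=
    fun e t =>
      (ContinuousLinearMap.snd ℝ (Fin n → ℝ) (Fin n → ℝ)).hasFDerivAt.comp_hasDerivAt t (hz e t)
  let Φ : E →ₗ[ℝ] E := (LinearMap.fst ℝ _ _).prod
    ((LinearMap.snd ℝ _ _ - P.mulVecLin ∘ₗ LinearMap.fst ℝ _ _) ∘ₗ
      (NormedSpace.exp (T • M) : E →L[ℝ] E).toLinearMap)
  have hΦ : ∀ e, Φ e = (e.1, (z e T).2 - P *ᵥ (z e T).1) := fun _ => rfl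
  have hinj : Function.Injective Φ := by
    refine (injective_iff_map_eq_zero Φ).2 fun e he => ?_
    rw [hΦ, Prod.mk_eq_zero, sub_eq_zero] at he
    have h := eq_zero_of_forwardBackward hT hG hK hP
      (fun t _ => (hfst e t).hasDerivWithinAt) (by rw [hz₀, he.1])
      (fun t _ => (hsnd e t).hasDerivWithinAt) he.2 0 (left_mem_Icc.2 hT)
    rw [hz₀] at h
    exact Prod.ext h.1 h.2
  obtain ⟨e, he⟩ := LinearMap.injective_iff_surjective.1 hinj (x₀, 0)
  rw [hΦ, Prod.mk.injEq, sub_eq_zero] at he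
  exact ⟨fun t => (z e t).1, fun t => (z e t).2, hfst e, (congrArg Prod.fst (hz₀ e)).trans he.1,
    hsnd e, he.2⟩

/-- Remark 3.8, constant coefficients with `Ā = 0`: if
`Q + Q̄(I − S)` is symmetric positive definite and the terminal weight
`Q_T + Q̄_T(I − S_T)` is symmetric positive semidefinite, then for every initial
datum (NewRic) has a unique solution on `[0, T]`. -/
theorem exists_unique_newRic_const_of_posDef
    (n m : ℕ) (T : ℝ) (hT : 0 < T)
    (A Abar S Q Qbar : Matrix (Fin n) (Fin n) ℝ)
    (B : Matrix (Fin n) (Fin m) ℝ)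
    (R : Matrix (Fin m) (Fin m) ℝ)
    (QT QbarT ST : Matrix (Fin n) (Fin n) ℝ)
    (hQ : Q.PosSemidef) (hQbar : Qbar.PosSemidef)
    (hR : R.PosDef)
    (hQT : QT.PosSemidef) (hQbarT : QbarT.PosSemidef)
    (hAbar0 : Abar = 0)
    (hconv : (Q + Qbar * (1 - S)).PosDef)
    (hterm : (QT + QbarT * (1 - ST)).PosSemidef)
    (x₀ : Fin n → ℝ) :
    (∃ ξ η : ℝ → Fin n → ℝ,
        IsNewRicSolConst n m T A Abar S Q Qbar B R QT QbarT ST x₀ ξ η) ∧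
    (∀ ξ₁ η₁ ξ₂ η₂ : ℝ → Fin n → ℝ,
        IsNewRicSolConst n m T A Abar S Q Qbar B R QT QbarT ST x₀ ξ₁ η₁ →
        IsNewRicSolConst n m T A Abar S Q Qbar B R QT QbarT ST x₀ ξ₂ η₂ →
        ∀ t ∈ Set.Icc (0:ℝ) T, ξ₁ t = ξ₂ t ∧ η₁ t = η₂ t) := by
  subst hAbar0
  have hG : (B * R⁻¹ * Bᵀ).PosSemidef := by
    simpa using hR.inv.posSemidef.mul_mul_conjTranspose_same B
  refine ⟨?_, ?_⟩
  · obtain ⟨ξ, η, hξ, hξ₀, hη, hηT⟩ :=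
      exists_forwardBackward (A := A) hT.le hG hconv hterm x₀
    refine ⟨ξ, η, fun t _ => ?_, hξ₀, fun t _ => (hη t).hasDerivWithinAt, hηT⟩
    rw [add_zero]
    exact (hξ t).hasDerivWithinAt
  · rintro ξ₁ η₁ ξ₂ η₂ ⟨hξ₁, hi₁, hη₁, hf₁⟩ ⟨hξ₂, hi₂, hη₂, hf₂⟩ t ht
    have h := eq_zero_of_forwardBackward (A := A) (ξ := ξ₁ - ξ₂) (η := η₁ - η₂)
      hT.le hG hconv hterm
      (fun s hs => ((hξ₁ s hs).sub (hξ₂ s hs)).congr_deriv (by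
        simp only [add_zero, Pi.sub_apply, mulVec_sub]; abel))
      (by simp [hi₁, hi₂])
      (fun s hs => ((hη₁ s hs).sub (hη₂ s hs)).congr_deriv (by
        simp only [Pi.sub_apply, mulVec_sub]; abel))
      (by simp [hf₁, hf₂, mulVec_sub]) t ht
    simpa [sub_eq_zero] using h

end
end

section
/- Let z : [0,T] → ℝⁿ be continuous and let (ξ, η) be continuously differentiable functions on [0,T] with values in ℝⁿ satisfying ξ'(t) = A_tξ(t) − B_tR_t⁻¹B_t^*η(t) + Ā_t z(t), ξ(0) = 0, −η'(t) = A_t^*η(t) + Q_tξ(t) + 𝒮_t z(t), η(T) = Q_Tξ(T) + 𝒮_T z(T). Then the following identity holds: ξ(T)^*Q_Tξ(T) + ∫₀ᵀ ξ(t)^*Q_tξ(t) dt + ∫₀ᵀ η(t)^*B_tR_t⁻¹B_t^*η(t) dt = ∫₀ᵀ η(t)^*Ā_t z(t) dt − ξ(T)^*𝒮_T z(T) − ∫₀ᵀ ξ(t)^*𝒮_t z(t) dt. -/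
open Matrix Set

noncomputable section

/-- Product rule for the dot product of two vector-valued functions. -/
lemma hasDerivWithinAt_dotProduct {ι : Type*} [Fintype ι] {f g : ℝ → ι → ℝ} {f' g' : ι → ℝ}
    {s : Set ℝ} {t : ℝ} (hf : HasDerivWithinAt f f' s t) (hg : HasDerivWithinAt g g' s t) :
    HasDerivWithinAt (fun t => f t ⬝ᵥ g t) (f' ⬝ᵥ g t + f t ⬝ᵥ g') s t := by
  rw [hasDerivWithinAt_pi] at hf hg
  simp only [dotProduct, ← Finset.sum_add_distrib]
  exact HasDerivWithinAt.fun_sum fun i _ => (hf i).mul (hg i)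

/-- Inversion preserves continuity of a matrix function on a set where it is nonsingular. -/
lemma continuousOn_matrix_inv {X ι : Type*} [TopologicalSpace X] [Fintype ι] [DecidableEq ι]
    {M : X → Matrix ι ι ℝ} {s : Set X} (hM : ContinuousOn M s) (h : ∀ x ∈ s, (M x).det ≠ 0) :
    ContinuousOn (fun x => (M x)⁻¹) s := by
  simp only [Matrix.inv_def, Ring.inverse_eq_inv']
  have hdet : ContinuousOn (fun x => (M x).det) s :=
    (continuous_id.matrix_det).comp_continuousOn hM
  have hadj : ContinuousOn (fun x => (M x).adjugate) s :=
    (continuous_id.matrix_adjugate).comp_continuousOn hM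
  exact (hdet.inv₀ h).smul hadj

/-- Continuity on a set of the bilinear expression `u ⬝ᵥ (M *ᵥ v)`. -/
lemma continuousOn_dotProduct_mulVec {X ι κ : Type*} [TopologicalSpace X] [Fintype ι] [Fintype κ]
    {u : X → ι → ℝ} {M : X → Matrix ι κ ℝ} {v : X → κ → ℝ} {s : Set X}
    (hu : ContinuousOn u s) (hM : ContinuousOn M s) (hv : ContinuousOn v s) :
    ContinuousOn (fun x => u x ⬝ᵥ (M x *ᵥ v x)) s := by
  rw [continuousOn_iff_continuous_domRestrict] at *
  exact hu.dotProduct (hM.matrix_mulVec hv)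

/-- Continuity on a set of a product of matrix functions. -/
lemma continuousOn_matrix_mul {X ι κ l : Type*} [TopologicalSpace X] [Fintype κ]
    {M : X → Matrix ι κ ℝ} {N : X → Matrix κ l ℝ} {s : Set X}
    (hM : ContinuousOn M s) (hN : ContinuousOn N s) :
    ContinuousOn (fun x => M x * N x) s := by
  rw [continuousOn_iff_continuous_domRestrict] at *
  exact hM.matrix_mul hN

/-- the energy identity (AuxId): if `(ξ, η)` solves the
forward–backward system with `ξ(0) = 0`, then
`ξ(T)ᵀQ_Tξ(T) + ∫₀ᵀ ξᵀQξ + ∫₀ᵀ ηᵀBR⁻¹Bᵀη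
  = ∫₀ᵀ ηᵀĀz − ξ(T)ᵀ𝒮_T z(T) − ∫₀ᵀ ξᵀ𝒮z`. -/
theorem aux_identity
    (n m : ℕ) (T : ℝ) (hT : 0 < T)
    (A Abar S Q Qbar : ℝ → Matrix (Fin n) (Fin n) ℝ)
    (B : ℝ → Matrix (Fin n) (Fin m) ℝ)
    (R : ℝ → Matrix (Fin m) (Fin m) ℝ)
    (QT QbarT ST : Matrix (Fin n) (Fin n) ℝ)
    (hAc : ContinuousOn A (Set.Icc 0 T)) (hAbarc : ContinuousOn Abar (Set.Icc 0 T))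
    (hBc : ContinuousOn B (Set.Icc 0 T)) (hSc : ContinuousOn S (Set.Icc 0 T))
    (hQc : ContinuousOn Q (Set.Icc 0 T)) (hQbarc : ContinuousOn Qbar (Set.Icc 0 T))
    (hRc : ContinuousOn R (Set.Icc 0 T))
    (hQ : ∀ t ∈ Set.Icc (0:ℝ) T, (Q t).PosSemidef)
    (hQbar : ∀ t ∈ Set.Icc (0:ℝ) T, (Qbar t).PosSemidef)
    (hR : ∀ t ∈ Set.Icc (0:ℝ) T, (R t).PosDef)
    (hQT : QT.PosSemidef) (hQbarT : QbarT.PosSemidef)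
    (z : ℝ → Fin n → ℝ) (hz : ContinuousOn z (Set.Icc 0 T))
    (ξ η : ℝ → Fin n → ℝ)
    (hξ : ∀ t ∈ Set.Icc (0:ℝ) T, HasDerivWithinAt ξ
        ((A t) *ᵥ ξ t - (B t * (R t)⁻¹ * (B t)ᵀ) *ᵥ η t + (Abar t) *ᵥ z t)
        (Set.Icc (0:ℝ) T) t)
    (hξ0 : ξ 0 = 0)
    (hη : ∀ t ∈ Set.Icc (0:ℝ) T, HasDerivWithinAt η
        (-((A t)ᵀ *ᵥ η t + (Q t) *ᵥ ξ t + (Qbar t * (1 - S t)) *ᵥ z t))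
        (Set.Icc (0:ℝ) T) t)
    (hηT : η T = QT *ᵥ ξ T + (QbarT * (1 - ST)) *ᵥ z T) :
    ξ T ⬝ᵥ (QT *ᵥ ξ T)
      + (∫ t in (0:ℝ)..T, ξ t ⬝ᵥ ((Q t) *ᵥ ξ t))
      + (∫ t in (0:ℝ)..T, η t ⬝ᵥ ((B t * (R t)⁻¹ * (B t)ᵀ) *ᵥ η t))
    = (∫ t in (0:ℝ)..T, η t ⬝ᵥ ((Abar t) *ᵥ z t))
      - ξ T ⬝ᵥ ((QbarT * (1 - ST)) *ᵥ z T)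
      - (∫ t in (0:ℝ)..T, ξ t ⬝ᵥ ((Qbar t * (1 - S t)) *ᵥ z t)) := by
  have hξc : ContinuousOn ξ (Icc 0 T) := fun t ht => (hξ t ht).continuousWithinAt
  have hηc : ContinuousOn η (Icc 0 T) := fun t ht => (hη t ht).continuousWithinAt
  have hMc : ContinuousOn (fun t => B t * (R t)⁻¹ * (B t)ᵀ) (Icc 0 T) :=
    continuousOn_matrix_mul
      (continuousOn_matrix_mul hBc
        (continuousOn_matrix_inv hRc fun t ht => (hR t ht).det_pos.ne'))
      ((continuous_id.matrix_transpose).comp_continuousOn hBc)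
  have hSSc : ContinuousOn (fun t => Qbar t * (1 - S t)) (Icc 0 T) :=
    continuousOn_matrix_mul hQbarc (continuousOn_const.sub hSc)
  have hint {f : ℝ → ℝ} (hf : ContinuousOn f (Icc 0 T)) :
      IntervalIntegrable f MeasureTheory.volume 0 T :=
    ContinuousOn.intervalIntegrable_of_Icc hT.le hf
  have i1 := hint (continuousOn_dotProduct_mulVec hηc hAbarc hz)
  have i2 := hint (continuousOn_dotProduct_mulVec hξc hQc hξc)
  have i3 := hint (continuousOn_dotProduct_mulVec hηc hMc hηc)
  have i4 := hint (continuousOn_dotProduct_mulVec hξc hSSc hz)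
  have hderiv : ∀ t ∈ Icc 0 T, HasDerivWithinAt (fun t => ξ t ⬝ᵥ η t)
      (η t ⬝ᵥ (Abar t *ᵥ z t) - ξ t ⬝ᵥ (Q t *ᵥ ξ t)
        - η t ⬝ᵥ ((B t * (R t)⁻¹ * (B t)ᵀ) *ᵥ η t)
        - ξ t ⬝ᵥ ((Qbar t * (1 - S t)) *ᵥ z t)) (Icc 0 T) t := by
    intro t ht
    refine (hasDerivWithinAt_dotProduct (hξ t ht) (hη t ht)).congr_deriv ?_
    have hA : ξ t ⬝ᵥ ((A t)ᵀ *ᵥ η t) = η t ⬝ᵥ (A t *ᵥ ξ t) := by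
      rw [mulVec_transpose, dotProduct_comm, dotProduct_mulVec]
    rw [dotProduct_comm _ (η t), dotProduct_neg]
    simp only [dotProduct_add, dotProduct_sub, hA]
    ring
  have hftc := intervalIntegral.integral_eq_sub_of_hasDerivAt_of_le hT.le
    (fun t ht => (hderiv t ht).continuousWithinAt)
    (fun t ht => (hderiv t (Ioo_subset_Icc_self ht)).hasDerivAt (Icc_mem_nhds ht.1 ht.2))
    (((i1.sub i2).sub i3).sub i4)
  rw [intervalIntegral.integral_sub ((i1.sub i2).sub i3) i4,
    intervalIntegral.integral_sub (i1.sub i2) i3, intervalIntegral.integral_sub i1 i2,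
    hξ0, zero_dotProduct, hηT, dotProduct_add] at hftc
  linarith

end
end

section
/- Let T > 0 and let Ā be a nonzero real number. Then there exists A₀ > 0 such that for every real A ≥ A₀ (in particular 2A + Ā ≠ 0 and 2A + 2Ā ≠ 0), one has (1/(2A + Ā))(1 − e^{−(2A + Ā)T}) ≠ e^{ĀT} · (1/(2A + 2Ā))(1 − e^{−(2A + 2Ā)T}). (This shows that, for A sufficiently large, the equilibrium strategy of the mean field game differs from the optimal control of the corresponding mean field type control problem.) -/
noncomputable section

/-- Section 6 comparison: for `T > 0` and `Ā ≠ 0` there is `A₀ > 0`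
such that for all `A ≥ A₀` one has `2A + Ā ≠ 0`, `2A + 2Ā ≠ 0` and
`(1/(2A + Ā))(1 − e^{−(2A + Ā)T}) ≠ e^{ĀT}(1/(2A + 2Ā))(1 − e^{−(2A + 2Ā)T})`;
hence the MFG equilibrium strategy and the mean-field-type optimal control differ. -/
theorem mfg_ne_mft_for_large_A
    (T : ℝ) (hT : 0 < T) (Abar : ℝ) (hAbar : Abar ≠ 0) :
    ∃ A₀ > (0:ℝ), ∀ A : ℝ, A₀ ≤ A →
      (2 * A + Abar ≠ 0) ∧ (2 * A + 2 * Abar ≠ 0) ∧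
      (1 / (2 * A + Abar)) * (1 - Real.exp (-(2 * A + Abar) * T))
        ≠ Real.exp (Abar * T)
          * ((1 / (2 * A + 2 * Abar)) * (1 - Real.exp (-(2 * A + 2 * Abar) * T))) := by
  set E := Real.exp (Abar * T) with hE
  have hE0 : 0 < E := Real.exp_pos _
  have hE1 : 1 - E ≠ 0 := by
    rw [sub_ne_zero, ne_comm, hE, Ne, Real.exp_eq_one_iff]
    exact mul_ne_zero hAbar hT.ne'
  have habs : 0 < |1 - E| := abs_pos.mpr hE1
  have ha : 0 < |Abar| := abs_pos.mpr hAbar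
  have hC : 0 < |Abar| * (2 + E + E⁻¹) / |1 - E| := by positivity
  refine ⟨|Abar| * (2 + E + E⁻¹) / |1 - E| + 2 * |Abar|, by positivity, fun A hA => ?_⟩
  have hlow := neg_abs_le Abar
  have hp : 0 < 2 * A + Abar := by linarith
  have hq : 0 < 2 * A + 2 * Abar := by linarith
  refine ⟨hp.ne', hq.ne', fun h => ?_⟩
  set u := Real.exp (-(2 * A * T)) with hu
  have hu0 : 0 < u := Real.exp_pos _
  have hu1 : u ≤ 1 := by
    rw [hu, Real.exp_le_one_iff, neg_nonpos]
    exact mul_nonneg (by linarith) hT.le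
  have e1 : Real.exp (-(2 * A + Abar) * T) = u * E⁻¹ := by
    rw [hu, hE, ← Real.exp_neg, ← Real.exp_add]
    ring_nf
  have e2 : Real.exp (-(2 * A + 2 * Abar) * T) = u * E⁻¹ * E⁻¹ := by
    rw [hu, hE, ← Real.exp_neg, ← Real.exp_add, ← Real.exp_add]
    ring_nf
  have key : 2 * A * (1 - E) = Abar * (u * E⁻¹ + E - 2) := by
    rw [e1, e2] at h
    have hr : A + Abar ≠ 0 := fun hr => hq.ne' (by linear_combination 2 * hr)
    field_simp at h ⊢
    linear_combination h
  have hbound : |u * E⁻¹ + E - 2| ≤ 2 + E + E⁻¹ := by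
    have hF : 0 < E⁻¹ := inv_pos.mpr hE0
    have h0 : 0 < u * E⁻¹ := mul_pos hu0 hF
    have h1 : u * E⁻¹ ≤ E⁻¹ := mul_le_of_le_one_left hF.le hu1
    rw [abs_le]
    constructor <;> linarith
  have hA0 : 0 < A := by linarith
  have hle : 2 * A * |1 - E| ≤ |Abar| * (2 + E + E⁻¹) := by
    have hkey := congrArg abs key
    rw [abs_mul, abs_mul Abar, abs_of_pos (show 0 < 2 * A by linarith)] at hkey
    rw [hkey]
    exact mul_le_mul_of_nonneg_left hbound ha.le
  have := (le_div_iff₀ habs).mpr hle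
  linarith

end
end
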